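/- For all n and k with 2 ≤ k ≤ n−2, there is no cyclic binary sequence s_1s_2⋯s_m of length m = C(n,k) (indices taken modulo m) such that the m cyclic windows s_i s_{i+1}⋯s_{i+n−1} of length n are pairwise distinct and form exactly the set of all binary strings of length n containing exactly k ones. That is, non-trivial universal cycles for the k-subsets of [n] using the length-n binary characteristic-vector representation do not exist. -/

import Mathlib

/-- The cyclic window of length `n` of `u` starting at position `i` (0-based). -/
def cycWindow (u : List ℕ) (n i : ℕ) : List ℕ :=
  (List.range n).map fun j => u.getD ((i + j) % u.length) 0

theorem lt_choose_of_two_le {n k : ℕ} (hk : 2 ≤ k) (hkn : k + 2 ≤ n) : n < n.choose k := by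
  induction n with
  | zero => omega
  | succ n ih =>
    obtain ⟨k, rfl⟩ : ∃ l, k = l + 1 := ⟨k - 1, by omega⟩
    rw [Nat.choose_succ_succ']
    rcases Nat.lt_or_ge n (k + 1 + 2) with h | h
    · obtain rfl : n = k + 2 := by omega
      have h₁ : (k + 2).choose (k + 1) = k + 2 := Nat.choose_succ_self_right (k + 1)
      have h₂ : (k + 2).choose k = (k + 1) + (k + 1).choose 2 := by
        rw [Nat.choose_symm_add, Nat.choose_succ_succ, Nat.choose_one_right]
      omega
    · have h₁ := ih h
      have h₂ : 0 < n.choose k := Nat.choose_pos (by omega)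
      omega

theorem cycWindow_mod (u : List ℕ) (n i : ℕ) :
    cycWindow u n (i % u.length) = cycWindow u n i := by
  simp [cycWindow]

theorem sum_cycWindow (u : List ℕ) (n i : ℕ) :
    (cycWindow u n i).sum = ∑ j ∈ Finset.range n, u.getD ((i + j) % u.length) 0 := rfl

/-- If all windows of length `n` have the same sum, the cyclic sequence has period `n`. -/
theorem cycWindow_add_of_sum_eq {u : List ℕ} {n k : ℕ}
    (h : ∀ i, (cycWindow u n i).sum = k) (i : ℕ) : cycWindow u n (n + i) = cycWindow u n i := by
  have period (p : ℕ) : u.getD ((p + n) % u.length) 0 = u.getD (p % u.length) 0 := by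
    have h₁ := Finset.sum_range_succ (fun j => u.getD ((p + j) % u.length) 0) n
    have h₂ := Finset.sum_range_succ' (fun j => u.getD ((p + j) % u.length) 0) n
    have h₃ := h p
    have h₄ := h (p + 1)
    rw [sum_cycWindow] at h₃ h₄
    simp only [add_assoc, add_comm 1, add_zero] at h₁ h₂ h₃ h₄
    omega
  refine List.map_congr_left fun j _ => ?_
  rw [← period (i + j), add_assoc, add_comm n]

/-- For all `n` and `k` with `2 ≤ k ≤ n−2`, there is no
cyclic binary sequence `s_1⋯s_m` of length `m = C(n,k)` whose `m` cyclic
windows of length `n` are pairwise distinct and form exactly the set of all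
binary strings of length `n` containing exactly `k` ones.  That is, non-trivial
universal cycles for the `k`-subsets of `[n]` using the length-`n` binary
characteristic-vector representation do not exist. -/
theorem stmt19 (n k : ℕ) (hk : 2 ≤ k) (hkn : k ≤ n - 2) :
    ¬ ∃ s : List ℕ, (∀ x ∈ s, x < 2) ∧ s.length = Nat.choose n k ∧
      (∀ i < s.length, ∀ j < s.length, cycWindow s n i = cycWindow s n j → i = j) ∧
      (∀ f : List ℕ, (f.length = n ∧ (∀ x ∈ f, x < 2) ∧ f.sum = k) ↔
        ∃ i < s.length, cycWindow s n i = f) := by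
  rintro ⟨s, -, hlen, hinj, hmem⟩
  have hlt : n < s.length := hlen ▸ lt_choose_of_two_le hk (by omega)
  have hsum (i : ℕ) : (cycWindow s n i).sum = k :=
    ((hmem _).2 ⟨i % s.length, Nat.mod_lt _ (by omega), cycWindow_mod s n i⟩).2.2
  have hn : n = 0 := hinj n hlt 0 (by omega) (cycWindow_add_of_sum_eq hsum 0)
  omega
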